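/- arXiv:2604.01846 — 2 statements merged into one kernel-verified Lean document; each statement's English description precedes it below -/
import Mathlib

section
/- Let M, M' ∈ N_s be non-critical. Suppose that for every pair (r,q) with 1 ≤ r and r+1 < q ≤ s there exists an invertible diagonal 2×2 matrix d_{r,q} (acting on ⟨e_r, e_{r+1}⟩) such that λ_r(M') = d_{r,q}·λ_r(M) and μ_{r,q}(M') = d_{r,q}·μ_{r,q}(M). Then there exists an invertible diagonal matrix d ∈ GL_s(E) with M' = dMd⁻¹; equivalently, T_s M' w_{0,s} B_s = T_s M w_{0,s} B_s. (This is the flag-variety form of the paper's theorem that the Hodge parameters of a non-critical crystalline (φ,Γ)-module are determined by the comparison maps ι^{r,q} between rank-2 subquotients, i.e., the map Φ^{cr}_{nc,s} → ∏_{r<r+1<q} T₂\(GL₂/B₂ × GL₂/B₂) is injective.) -/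
/-!
Statement 4: a non-critical crystalline Hodge parameter is determined by the data
`(λ_r, μ_{r,q})`: if for every pair `(r,q)` with `r+1 < q ≤ s` there is an invertible
diagonal `2×2` matrix `d_{r,q}` carrying `(λ_r(M), μ_{r,q}(M))` to
`(λ_r(M'), μ_{r,q}(M'))`, then `M' = d M d⁻¹` for an invertible diagonal `d`.
Positions are 0-based (the 1-based `e_r, e_{r+1}` are the coordinates `r-1, r`);
the indices `r, q` remain 1-based.
-/

open scoped Classical

noncomputable section

namespace Stmt4

/-- The permutation matrix `[v]`, characterized by `[v] · eⱼ = e_{v j}`. -/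
def permMat (E : Type*) [Field E] {s : ℕ} (v : Equiv.Perm (Fin s)) :
    Matrix (Fin s) (Fin s) E :=
  Matrix.of fun i j => if i = v j then 1 else 0

/-- The antidiagonal permutation matrix `w_{0,s}`. -/
def w0Mat (E : Type*) [Field E] (s : ℕ) : Matrix (Fin s) (Fin s) E :=
  Matrix.of fun i j => if (i : ℕ) + (j : ℕ) + 1 = s then 1 else 0

variable {E : Type*} [Field E]

/-- Membership in the Borel subgroup `B_s` of invertible upper triangular matrices. -/
def IsBorel {s : ℕ} (b : Matrix (Fin s) (Fin s) E) : Prop :=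
  IsUnit b ∧ ∀ i j : Fin s, j < i → b i j = 0

/-- Upper triangular unipotent matrices (the group `N_s`). -/
def IsUniUpper {s : ℕ} (m : Matrix (Fin s) (Fin s) E) : Prop :=
  (∀ i j : Fin s, j < i → m i j = 0) ∧ ∀ i : Fin s, m i i = 1

/-- Membership in the big Bruhat cell `B_s w_{0,s} B_s`. -/
def InBigCell {s : ℕ} (g : Matrix (Fin s) (Fin s) E) : Prop :=
  ∃ b b' : Matrix (Fin s) (Fin s) E, IsBorel b ∧ IsBorel b' ∧ g = b * w0Mat E s * b'

/-- `F_i(M)`: the span of the last `i` columns of `M`. -/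
def lastCols {s : ℕ} (M : Matrix (Fin s) (Fin s) E) (i : ℕ) :
    Submodule E (Fin s → E) :=
  Submodule.span E { v | ∃ j : Fin s, s ≤ (j : ℕ) + i ∧ v = fun k => M k j }

/-- The span of the standard basis vectors `e_p` with `p ∈ P` (0-based positions). -/
def coordSpan (E : Type*) [Field E] (s : ℕ) (P : Set ℕ) : Submodule E (Fin s → E) :=
  Submodule.span E { v | ∃ p : Fin s, (p : ℕ) ∈ P ∧ v = Pi.single p 1 }

/-- The projection onto the coordinates `r-1, r` (the identification of
`⟨e₁,…,e_{r+1}⟩/⟨e₁,…,e_{r-1}⟩`, and of `⟨e₁,…,e_{r+1},e_q⟩/(⟨e₁,…,e_{r-1}⟩+⟨e_q⟩)`,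
with `⟨e_r, e_{r+1}⟩` via the images of `e_r, e_{r+1}`). -/
def projTwo (E : Type*) [Field E] (s : ℕ) (r : ℕ) : (Fin s → E) →ₗ[E] (Fin s → E) :=
  (Matrix.diagonal fun p : Fin s =>
    if (p : ℕ) + 1 = r ∨ (p : ℕ) = r then (1 : E) else 0).mulVecLin

/-- The invertible diagonal `2×2` matrix `diag(α,β)` acting on `⟨e_r, e_{r+1}⟩`
(extended by the identity elsewhere). -/
def diagScale (E : Type*) [Field E] (s : ℕ) (r : ℕ) (α β : E) :
    (Fin s → E) →ₗ[E] (Fin s → E) :=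
  (Matrix.diagonal fun p : Fin s =>
    if (p : ℕ) + 1 = r then α else if (p : ℕ) = r then β else 1).mulVecLin

/-- `L = λ_r(M)`: `L` is a one-dimensional member of the filtration induced by `F_•(M)` on
`Q_r = ⟨e₁,…,e_{r+1}⟩/⟨e₁,…,e_{r-1}⟩`, identified with `⟨e_r, e_{r+1}⟩`. -/
def IsLambda {s : ℕ} (r : ℕ) (M : Matrix (Fin s) (Fin s) E)
    (L : Submodule E (Fin s → E)) : Prop :=
  ∃ i : ℕ, L = Submodule.map (projTwo E s r)
      ((lastCols M i ⊓ coordSpan E s {p | p < r + 1}) ⊔ coordSpan E s {p | p + 1 < r}) ∧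
    Module.finrank E L = 1

/-- `L = μ_{r,q}(M)`: `L` is a one-dimensional member of the filtration induced by
`F_•(M)` on `Q_{r,q} = ⟨e₁,…,e_{r+1},e_q⟩/(⟨e₁,…,e_{r-1}⟩+⟨e_q⟩)`, identified with
`⟨e_r, e_{r+1}⟩`. -/
def IsMu {s : ℕ} (r q : ℕ) (M : Matrix (Fin s) (Fin s) E)
    (L : Submodule E (Fin s → E)) : Prop :=
  ∃ i : ℕ, L = Submodule.map (projTwo E s r)
      ((lastCols M i ⊓ coordSpan E s ({p | p < r + 1} ∪ {p | p + 1 = q})) ⊔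
        coordSpan E s ({p | p + 1 < r} ∪ {p | p + 1 = q})) ∧
    Module.finrank E L = 1

section CoordinateSubspaces

variable {s : ℕ}

lemma mem_coordSpan {P : Set ℕ} {v : Fin s → E} :
    v ∈ coordSpan E s P ↔ ∀ p : Fin s, (p : ℕ) ∉ P → v p = 0 := by
  constructor
  · intro hv p hp
    have hle : coordSpan E s P ≤ LinearMap.ker (LinearMap.proj (R := E) (φ := fun _ => E) p) := by
      refine Submodule.span_le.2 ?_
      rintro _ ⟨t, ht, rfl⟩
      have hne : p ≠ t := by rintro rfl; exact hp ht
      simp [hne]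
    simpa using hle hv
  · intro hv
    rw [pi_eq_sum_univ' v]
    refine Submodule.sum_mem _ fun p _ => ?_
    by_cases hp : (p : ℕ) ∈ P
    · refine Submodule.smul_mem _ _ (Submodule.subset_span ⟨p, hp, ?_⟩)
      ext k
      simp [Pi.single_apply, eq_comm]
    · simp [hv p hp]

/-- The vector with coordinates `x` at `a` and `y` at `b`. -/
def pairVec (a b : Fin s) (x y : E) : Fin s → E :=
  Pi.single a x + Pi.single b y

lemma pairVec_left {a b : Fin s} (hab : a ≠ b) (x y : E) : pairVec a b x y a = x := by
  simp [pairVec, hab]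

lemma pairVec_right {a b : Fin s} (hab : a ≠ b) (x y : E) : pairVec a b x y b = y := by
  simp [pairVec, hab.symm]

lemma smul_pairVec (a b : Fin s) (t x y : E) :
    t • pairVec a b x y = pairVec a b (t * x) (t * y) := by
  ext k
  simp [pairVec, Pi.single_apply, mul_add]

lemma pairVec_ext {a b : Fin s} (hab : a ≠ b) {x y x' y' : E}
    (h : pairVec a b x y = pairVec a b x' y') : x = x' ∧ y = y' := by
  have h1 := congrFun h a
  have h2 := congrFun h b
  rw [pairVec_left hab, pairVec_left hab] at h1
  rw [pairVec_right hab, pairVec_right hab] at h2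
  exact ⟨h1, h2⟩

lemma projTwo_apply {a b : Fin s} (hab : (a : ℕ) + 1 = b) (v : Fin s → E) :
    projTwo E s b v = pairVec a b (v a) (v b) := by
  ext k
  have hne : a ≠ b := by rintro rfl; omega
  simp only [projTwo, Matrix.mulVecLin_apply, Matrix.mulVec_diagonal]
  by_cases ha : k = a
  · subst ha
    simp [pairVec_left hne, hab]
  by_cases hb : k = b
  · subst hb
    simp [pairVec_right hne]
  have h1 : ¬ ((k : ℕ) + 1 = b ∨ (k : ℕ) = b) := by
    rintro (h | h)
    · exact ha (Fin.ext (by omega))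
    · exact hb (Fin.ext h)
  simp [pairVec, h1, ha, hb]

lemma diagScale_pairVec {a b : Fin s} (hab : (a : ℕ) + 1 = b) (α β x y : E) :
    diagScale E s b α β (pairVec a b x y) = pairVec a b (α * x) (β * y) := by
  ext k
  have hne : a ≠ b := by rintro rfl; omega
  simp only [diagScale, Matrix.mulVecLin_apply, Matrix.mulVec_diagonal]
  by_cases ha : k = a
  · subst ha
    simp [pairVec_left hne, hab]
  by_cases hb : k = b
  · subst hb
    simp [pairVec_right hne]
  simp [pairVec, ha, hb]

lemma mul_eq_mul_of_finrank_eq_one {a b : Fin s} (hab : a ≠ b)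
    {L : Submodule E (Fin s → E)} (hL : Module.finrank E L = 1) {x y x' y' : E}
    (h : pairVec a b x y ∈ L) (h' : pairVec a b x' y' ∈ L) : x * y' = x' * y := by
  obtain ⟨w, -, hw⟩ := finrank_eq_one_iff'.1 hL
  obtain ⟨t, ht⟩ := hw ⟨_, h⟩
  obtain ⟨t', ht'⟩ := hw ⟨_, h'⟩
  have e : t • (w : Fin s → E) = pairVec a b x y := congrArg Subtype.val ht
  have e' : t' • (w : Fin s → E) = pairVec a b x' y' := congrArg Subtype.val ht'
  have ea := congrFun e a
  have eb := congrFun e b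
  have ea' := congrFun e' a
  have eb' := congrFun e' b
  rw [pairVec_left hab] at ea ea'
  rw [pairVec_right hab] at eb eb'
  rw [← ea, ← eb, ← ea', ← eb']
  simp only [Pi.smul_apply, smul_eq_mul]
  ring

lemma map_projTwo_sup {a b : Fin s} (hab : (a : ℕ) + 1 = b) (A : Submodule E (Fin s → E))
    {P : Set ℕ} (ha : (a : ℕ) ∉ P) (hb : (b : ℕ) ∉ P) :
    (A ⊔ coordSpan E s P).map (projTwo E s b) = A.map (projTwo E s b) := by
  rw [Submodule.map_sup, sup_eq_left]
  rintro _ ⟨v, hv, rfl⟩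
  have hv := mem_coordSpan.1 hv
  rw [projTwo_apply hab, hv a ha, hv b hb]
  simp [pairVec]

end CoordinateSubspaces

section InversePair

open scoped Matrix

variable {s : ℕ}

lemma IsUniUpper.isUnit_det {M : Matrix (Fin s) (Fin s) E} (hM : IsUniUpper M) :
    IsUnit M.det := by
  rw [Matrix.det_of_isUpperTriangular (fun i j hij => hM.1 i j hij)]
  simp [hM.2]

lemma inv_apply_eq_zero_of_lt {b : Matrix (Fin s) (Fin s) E} (hb : IsUnit b)
    (hu : ∀ i j : Fin s, j < i → b i j = 0) {i j : Fin s} (hij : j < i) : b⁻¹ i j = 0 := by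
  have : Invertible b := hb.invertible
  have hbt : b.BlockTriangular id := fun i j hij => hu i j hij
  exact Matrix.blockTriangular_inv_of_blockTriangular hbt hij

lemma IsUniUpper.inv {M : Matrix (Fin s) (Fin s) E} (hM : IsUniUpper M) : IsUniUpper M⁻¹ := by
  have hup : ∀ i j : Fin s, j < i → M⁻¹ i j = 0 := fun i j hij =>
    inv_apply_eq_zero_of_lt ((Matrix.isUnit_iff_isUnit_det _).2 hM.isUnit_det) hM.1 hij
  refine ⟨hup, fun i => ?_⟩
  have h := congrFun (congrFun (Matrix.nonsing_inv_mul M hM.isUnit_det) i) i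
  rw [Matrix.mul_apply, Finset.sum_eq_single i] at h
  · simpa [hM.2] using h
  · intro j _ hj
    rcases lt_or_gt_of_ne hj with hj | hj
    · rw [hup i j hj, zero_mul]
    · rw [hM.1 j i hj, mul_zero]
  · simp

lemma IsUniUpper.apply_succ {M : Matrix (Fin s) (Fin s) E} (hM : IsUniUpper M)
    {a b : Fin s} (hab : (a : ℕ) + 1 = b) : M a b = -M⁻¹ a b := by
  have hne : a ≠ b := by rintro rfl; omega
  have h := congrFun (congrFun (Matrix.mul_nonsing_inv M hM.isUnit_det) a) b
  rw [Matrix.mul_apply, Fintype.sum_eq_add a b hne] at h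
  · rw [hM.2, hM.inv.2, Matrix.one_apply_ne hne] at h
    linear_combination h
  · rintro j ⟨ha, hb⟩
    rcases lt_or_gt_of_ne ha with hj | hj
    · rw [hM.1 a j hj, zero_mul]
    · rw [hM.inv.1 j b, mul_zero]
      have : (a : ℕ) < j := hj
      have : (j : ℕ) ≠ b := fun h => hb (Fin.ext h)
      exact Fin.lt_def.2 (by omega)

lemma inv_mulVec_col {M : Matrix (Fin s) (Fin s) E} (hM : IsUniUpper M) (j : Fin s) :
    M⁻¹ *ᵥ (fun k => M k j) = Pi.single j 1 := by
  have h : (fun k => M k j) = M *ᵥ Pi.single j 1 := by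
    ext k
    simp
  rw [h, Matrix.mulVec_mulVec, Matrix.nonsing_inv_mul M hM.isUnit_det, Matrix.one_mulVec]

lemma mem_lastCols {M : Matrix (Fin s) (Fin s) E} (hM : IsUniUpper M) {i : ℕ}
    {v : Fin s → E} :
    v ∈ lastCols M i ↔ ∀ j : Fin s, (j : ℕ) + i < s → (M⁻¹ *ᵥ v) j = 0 := by
  constructor
  · intro hv j hj
    have hle : lastCols M i ≤
        LinearMap.ker ((LinearMap.proj (R := E) (φ := fun _ => E) j).comp M⁻¹.mulVecLin) := by
      refine Submodule.span_le.2 ?_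
      rintro _ ⟨t, ht, rfl⟩
      have hne : j ≠ t := by rintro rfl; omega
      simp [inv_mulVec_col hM, hne]
    simpa using hle hv
  · intro hv
    have h : v = ∑ j, (M⁻¹ *ᵥ v) j • fun k => M k j := by
      conv_lhs => rw [← Matrix.one_mulVec v, ← Matrix.mul_nonsing_inv M hM.isUnit_det,
        ← Matrix.mulVec_mulVec]
      ext k
      simp [Matrix.mulVec, dotProduct, mul_comm]
    rw [h]
    refine Submodule.sum_mem _ fun j _ => ?_
    by_cases hj : (j : ℕ) + i < s
    · simp [hv j hj]
    · exact Submodule.smul_mem _ _ (Submodule.subset_span ⟨j, by omega, rfl⟩)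

/-- `e_c` with the components of `M⁻¹ e_c` at positions `≤ b` removed in the basis of columns
of `M`. -/
def truncVec (M : Matrix (Fin s) (Fin s) E) (b c : Fin s) : Fin s → E :=
  M *ᵥ fun j => if j ≤ b then 0 else M⁻¹ j c

lemma inv_mulVec_truncVec {M : Matrix (Fin s) (Fin s) E} (hM : IsUniUpper M) (b c : Fin s) :
    M⁻¹ *ᵥ truncVec M b c = fun j => if j ≤ b then 0 else M⁻¹ j c := by
  rw [truncVec, Matrix.mulVec_mulVec, Matrix.nonsing_inv_mul M hM.isUnit_det, Matrix.one_mulVec]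

lemma truncVec_apply {M : Matrix (Fin s) (Fin s) E} (hM : IsUniUpper M) (b c p : Fin s) :
    truncVec M b c p =
      (if p = c then 1 else 0) - ∑ j, if j ≤ b then M p j * M⁻¹ j c else 0 := by
  have h := congrFun (congrFun (Matrix.mul_nonsing_inv M hM.isUnit_det) p) c
  rw [Matrix.mul_apply, Matrix.one_apply] at h
  rw [← h, ← Finset.sum_sub_distrib, truncVec, Matrix.mulVec, dotProduct]
  refine Finset.sum_congr rfl fun j _ => ?_
  split_ifs <;> simp

lemma truncVec_of_lt {M : Matrix (Fin s) (Fin s) E} (hM : IsUniUpper M) {b c p : Fin s}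
    (hp : b < p) : truncVec M b c p = if p = c then 1 else 0 := by
  rw [truncVec_apply hM, Finset.sum_eq_zero, sub_zero]
  intro j _
  split_ifs with hj
  · rw [hM.1 p j (hj.trans_lt hp), zero_mul]
  · rfl

lemma truncVec_self {M : Matrix (Fin s) (Fin s) E} (hM : IsUniUpper M) {b c : Fin s}
    (hbc : b < c) : truncVec M b c b = -M⁻¹ b c := by
  rw [truncVec_apply hM, if_neg hbc.ne, Finset.sum_eq_single b]
  · simp [hM.2]
  · intro j _ hj
    split_ifs with h
    · rw [hM.1 b j (lt_of_le_of_ne h hj), zero_mul]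
    · rfl
  · simp

lemma truncVec_pred {M : Matrix (Fin s) (Fin s) E} (hM : IsUniUpper M) {a b c : Fin s}
    (hab : (a : ℕ) + 1 = b) (hbc : b < c) :
    truncVec M b c a = M⁻¹ a b * M⁻¹ b c - M⁻¹ a c := by
  have hlt : a < b := Fin.lt_def.2 (by omega)
  rw [truncVec_apply hM, if_neg (hlt.trans hbc).ne, Fintype.sum_eq_add a b hlt.ne]
  · rw [if_pos hlt.le, if_pos le_rfl, hM.2, hM.apply_succ hab]
    ring
  · rintro j ⟨ha, hb⟩
    split_ifs with h
    · have h1 : (j : ℕ) ≤ b := h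
      have h2 : (j : ℕ) ≠ a := fun h => ha (Fin.ext h)
      have h3 : (j : ℕ) ≠ b := fun h => hb (Fin.ext h)
      rw [hM.1 a j (Fin.lt_def.2 (by omega)), zero_mul]
    · rfl

end InversePair

section NonCritical

open scoped Matrix

variable {s : ℕ}

lemma w0Mat_mulVec (x : Fin s → E) (i : Fin s) : (w0Mat E s *ᵥ x) i = x i.rev := by
  rw [Matrix.mulVec, dotProduct, Finset.sum_eq_single i.rev]
  · have h : (i : ℕ) + (i.rev : ℕ) + 1 = s := by rw [Fin.val_rev]; omega
    rw [w0Mat, Matrix.of_apply, if_pos h, one_mul]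
  · intro j _ hj
    have h : ¬ (i : ℕ) + (j : ℕ) + 1 = s := fun h => hj (Fin.ext (by rw [Fin.val_rev]; omega))
    rw [w0Mat, Matrix.of_apply, if_neg h, zero_mul]
  · simp

lemma permMat_mulVec (σ : Equiv.Perm (Fin s)) (x : Fin s → E) (i : Fin s) :
    (permMat E σ *ᵥ x) i = x (σ.symm i) := by
  rw [Matrix.mulVec, dotProduct, Finset.sum_eq_single (σ.symm i)]
  · simp [permMat]
  · intro j _ hj
    have h : i ≠ σ j := by rintro rfl; simp at hj
    simp [permMat, h]
  · simp

/-- A flag in the big cell is transverse to the standard flag. -/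
lemma InBigCell.mulVec_eq_zero {g : Matrix (Fin s) (Fin s) E} (hg : InBigCell g) {a : Fin s}
    {y : Fin s → E} (hy : ∀ j : Fin s, j.rev ≤ a → y j = 0)
    (hgy : ∀ i : Fin s, a < i → (g *ᵥ y) i = 0) : g *ᵥ y = 0 := by
  obtain ⟨b, b', hb, hb', rfl⟩ := hg
  set z := w0Mat E s *ᵥ (b' *ᵥ y) with hz
  have hgz : (b * w0Mat E s * b') *ᵥ y = b *ᵥ z := by
    rw [hz, Matrix.mulVec_mulVec, Matrix.mulVec_mulVec, Matrix.mul_assoc]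
  rw [hgz] at hgy ⊢
  have hzb : z = b⁻¹ *ᵥ (b *ᵥ z) := by
    rw [Matrix.mulVec_mulVec,
      Matrix.nonsing_inv_mul b ((Matrix.isUnit_iff_isUnit_det _).1 hb.1), Matrix.one_mulVec]
  have hz0 : z = 0 := by
    ext i
    rcases lt_or_ge a i with hi | hi
    · rw [hzb, Matrix.mulVec, dotProduct, Pi.zero_apply]
      refine Finset.sum_eq_zero fun j _ => ?_
      rcases lt_or_ge a j with hj | hj
      · rw [hgy j hj, mul_zero]
      · rw [inv_apply_eq_zero_of_lt hb.1 hb.2 (hj.trans_lt hi), zero_mul]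
    · rw [hz, w0Mat_mulVec, Matrix.mulVec, dotProduct, Pi.zero_apply]
      refine Finset.sum_eq_zero fun j _ => ?_
      rcases le_or_gt j.rev a with hj | hj
      · rw [hy j hj, mul_zero]
      · rw [hb'.2 i.rev j (by rw [← Fin.rev_lt_rev, Fin.rev_rev]; exact hi.trans_lt hj), zero_mul]
  rw [hz0, Matrix.mulVec_zero]

lemma inv_apply_ne_zero {M : Matrix (Fin s) (Fin s) E} (hM : IsUniUpper M)
    (hnc : ∀ v : Equiv.Perm (Fin s), InBigCell (permMat E v * M * w0Mat E s))
    {a c : Fin s} (hac : a < c) : M⁻¹ a c ≠ 0 := by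
  intro h0
  set x : Fin s → E := fun j => if j ≤ a then 0 else M⁻¹ j c
  have hv : (permMat E (Equiv.swap a c) * M * w0Mat E s) *ᵥ (fun j => x j.rev) =
      permMat E (Equiv.swap a c) *ᵥ truncVec M a c := by
    have hw : w0Mat E s *ᵥ (fun j => x j.rev) = x := by
      ext j
      rw [w0Mat_mulVec, Fin.rev_rev]
    rw [← Matrix.mulVec_mulVec, hw, ← Matrix.mulVec_mulVec, truncVec]
  have hzero := (hnc (Equiv.swap a c)).mulVec_eq_zero (a := a) (y := fun j => x j.rev)
    (fun j hj => if_pos hj) (fun i hi => by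
      rw [hv, permMat_mulVec, Equiv.symm_swap]
      by_cases hic : i = c
      · rw [hic, Equiv.swap_apply_right, truncVec_self hM hac, h0, neg_zero]
      · rw [Equiv.swap_apply_of_ne_of_ne hi.ne' hic, truncVec_of_lt hM hi, if_neg hic])
  have h1 := congrFun hzero a
  rw [hv, permMat_mulVec, Equiv.symm_swap, Equiv.swap_apply_left, truncVec_of_lt hM hac,
    if_pos rfl] at h1
  exact one_ne_zero h1

end NonCritical

section InducedLines

open scoped Matrix

variable {s : ℕ} {M : Matrix (Fin s) (Fin s) E} {a b c : Fin s}

lemma inv_mulVec_eq_add (hM : IsUniUpper M) {v : Fin s → E} {P : Set ℕ}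
    (hv : v ∈ coordSpan E s P) (i j : Fin s) (hij : i < j)
    (hP : ∀ p : Fin s, i < p → (p : ℕ) ∈ P → p = j) :
    (M⁻¹ *ᵥ v) i = v i + M⁻¹ i j * v j := by
  rw [Matrix.mulVec, dotProduct, Fintype.sum_eq_add i j hij.ne, hM.inv.2, one_mul]
  rintro p ⟨hpi, hpj⟩
  rcases lt_or_gt_of_ne hpi with hp | hp
  · rw [hM.inv.1 i p hp, zero_mul]
  · rw [mem_coordSpan.1 hv p fun h => hpj (hP p hp h), mul_zero]

lemma col_mem_coordSpan (hM : IsUniUpper M) {b j : Fin s} (hj : j ≤ b) {P : Set ℕ}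
    (hP : {p : ℕ | p < b + 1} ⊆ P) : (fun k => M k j) ∈ coordSpan E s P := by
  refine mem_coordSpan.2 fun p hp => hM.1 p j (hj.trans_lt ?_)
  by_contra h
  exact hp (hP (Nat.lt_succ_of_le (not_lt.1 h)))

lemma isLambda_span (hM : IsUniUpper M) (hab : (a : ℕ) + 1 = b) :
    IsLambda b M (Submodule.span E {pairVec a b (-M⁻¹ a b) 1}) := by
  have hlt : a < b := Fin.lt_def.2 (by omega)
  refine ⟨s - b, ?_, finrank_span_singleton fun h => ?_⟩
  · rw [map_projTwo_sup hab _ (by simp [hab]) (by simp)]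
    apply le_antisymm
    · rw [Submodule.span_singleton_le_iff_mem]
      refine ⟨fun k => M k b, ⟨(mem_lastCols hM).2 fun j hj => ?_,
        col_mem_coordSpan hM le_rfl subset_rfl⟩, ?_⟩
      · have : j ≠ b := by rintro rfl; omega
        simp [inv_mulVec_col hM, this]
      · rw [projTwo_apply hab, hM.2, hM.apply_succ hab]
    · rintro _ ⟨v, ⟨hv, hv'⟩, rfl⟩
      have h := (mem_lastCols hM).1 hv a (by omega)
      rw [inv_mulVec_eq_add hM hv' a b hlt (fun p hp hp' => Fin.ext (by
        have : (p : ℕ) < b + 1 := hp'; have : (a : ℕ) < p := hp; omega))] at h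
      rw [projTwo_apply hab, Submodule.mem_span_singleton]
      refine ⟨v b, ?_⟩
      rw [smul_pairVec, mul_one]
      congr 1
      linear_combination -h
  · have := congrFun h b
    rw [pairVec_right hlt.ne] at this
    simp at this

lemma IsLambda.le_span (hM : IsUniUpper M) (hab : (a : ℕ) + 1 = b)
    {L : Submodule E (Fin s → E)} (hL : IsLambda b M L) :
    L ≤ Submodule.span E {pairVec a b (-M⁻¹ a b) 1} := by
  have hlt : a < b := Fin.lt_def.2 (by omega)
  obtain ⟨i, hL, hrank⟩ := hL
  rw [map_projTwo_sup hab _ (by simp [hab]) (by simp)] at hL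
  by_cases hi : (a : ℕ) + i < s
  · rw [hL]
    rintro _ ⟨v, ⟨hv, hv'⟩, rfl⟩
    have h := (mem_lastCols hM).1 hv a hi
    rw [inv_mulVec_eq_add hM hv' a b hlt (fun p hp hp' => Fin.ext (by
      have : (p : ℕ) < b + 1 := hp'; have : (a : ℕ) < p := hp; omega))] at h
    rw [projTwo_apply hab, Submodule.mem_span_singleton]
    refine ⟨v b, ?_⟩
    rw [smul_pairVec, mul_one]
    congr 1
    linear_combination -h
  · have key : ∀ j : Fin s, a ≤ j → j ≤ b → pairVec a b (M a j) (M b j) ∈ L := by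
      intro j haj hjb
      have haj' : (a : ℕ) ≤ j := haj
      rw [hL]
      exact ⟨fun k => M k j, ⟨Submodule.subset_span ⟨j, by omega, rfl⟩,
        col_mem_coordSpan hM hjb subset_rfl⟩, projTwo_apply hab _⟩
    have h := mul_eq_mul_of_finrank_eq_one hlt.ne hrank (key a le_rfl hlt.le) (key b hlt.le le_rfl)
    rw [hM.2, hM.2, hM.1 b a hlt] at h
    simp at h

lemma inv_mulVec_eq_add_add (hM : IsUniUpper M) {v : Fin s → E} (hab : (a : ℕ) + 1 = b)
    (hbc : b < c)
    (hv : v ∈ coordSpan E s ({p : ℕ | p < b + 1} ∪ {p | p + 1 = c + 1})) :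
    (M⁻¹ *ᵥ v) a = v a + M⁻¹ a b * v b + M⁻¹ a c * v c := by
  have hlt : a < b := Fin.lt_def.2 (by omega)
  rw [Matrix.mulVec, dotProduct, ← Finset.sum_subset (Finset.subset_univ {a, b, c}),
    Finset.sum_insert (by simp [hlt.ne, (hlt.trans hbc).ne]), Finset.sum_pair hbc.ne, hM.inv.2,
    one_mul, add_assoc]
  intro p _ hp
  simp only [Finset.mem_insert, Finset.mem_singleton, not_or] at hp
  obtain ⟨hpa, hpb, hpc⟩ := hp
  rcases lt_or_gt_of_ne hpa with h | h
  · rw [hM.inv.1 a p h, zero_mul]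
  · have h' : (a : ℕ) < p := h
    rw [mem_coordSpan.1 hv p, mul_zero]
    rintro (hp | hp)
    · have hp : (p : ℕ) < b + 1 := hp
      exact hpb (Fin.ext (by omega))
    · exact hpc (Fin.ext (Nat.succ_injective hp))

/-- The vector spanning `μ_{r,q}(M)`, in terms of the entries of `M⁻¹`. -/
def muVec (M : Matrix (Fin s) (Fin s) E) (a b c : Fin s) : Fin s → E :=
  pairVec a b (M⁻¹ a b * M⁻¹ b c - M⁻¹ a c) (-M⁻¹ b c)

lemma map_projTwo_muFiltration (hab : (a : ℕ) + 1 = b) (hbc : b < c) (F : Submodule E (Fin s → E)) :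
    Submodule.map (projTwo E s b)
      ((F ⊓ coordSpan E s ({p | p < (b : ℕ) + 1} ∪ {p | p + 1 = (c : ℕ) + 1})) ⊔
        coordSpan E s ({p | p + 1 < (b : ℕ)} ∪ {p | p + 1 = (c : ℕ) + 1})) =
      (F ⊓ coordSpan E s ({p | p < (b : ℕ) + 1} ∪ {p | p + 1 = (c : ℕ) + 1})).map
        (projTwo E s b) := by
  have hbc' : (b : ℕ) < c := hbc
  refine map_projTwo_sup hab _ ?_ ?_
  · rintro (h | h)
    · exact absurd (show (a : ℕ) + 1 < b from h) (by omega)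
    · exact absurd (show (a : ℕ) + 1 = c + 1 from h) (by omega)
  · rintro (h | h)
    · exact absurd (show (b : ℕ) + 1 < b from h) (by omega)
    · exact absurd (show (b : ℕ) + 1 = c + 1 from h) (by omega)

lemma projTwo_mem_span_muVec (hM : IsUniUpper M) (hab : (a : ℕ) + 1 = b) (hbc : b < c)
    {v : Fin s → E} (hv : v ∈ coordSpan E s ({p : ℕ | p < b + 1} ∪ {p | p + 1 = c + 1}))
    (ha : (M⁻¹ *ᵥ v) a = 0) (hb : (M⁻¹ *ᵥ v) b = 0) :
    projTwo E s b v ∈ Submodule.span E {muVec M a b c} := by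
  rw [inv_mulVec_eq_add_add hM hab hbc hv] at ha
  rw [inv_mulVec_eq_add hM hv b c hbc] at hb
  · rw [projTwo_apply hab, Submodule.mem_span_singleton]
    refine ⟨v c, ?_⟩
    rw [muVec, smul_pairVec]
    congr 1
    · linear_combination M⁻¹ a b * hb - ha
    · linear_combination -hb
  · intro p hp hp'
    have hp : (b : ℕ) < p := hp
    rcases hp' with h | h
    · have h : (p : ℕ) < b + 1 := h
      omega
    · exact Fin.ext (Nat.succ_injective h)

lemma muVec_mem_map (hM : IsUniUpper M) (hab : (a : ℕ) + 1 = b) (hbc : b < c) {i : ℕ}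
    (hi : s ≤ b + 1 + i) :
    muVec M a b c ∈
      (lastCols M i ⊓ coordSpan E s ({p | p < (b : ℕ) + 1} ∪ {p | p + 1 = (c : ℕ) + 1})).map
        (projTwo E s b) := by
  refine ⟨truncVec M b c, ⟨(mem_lastCols hM).2 fun j hj => ?_, mem_coordSpan.2 fun p hp => ?_⟩, ?_⟩
  · rw [inv_mulVec_truncVec hM]
    exact if_pos (Fin.le_def.2 (by omega))
  · have hbp : b < p := by
      by_contra h
      exact hp (Or.inl (Nat.lt_succ_of_le (not_lt.1 h)))
    have hpc : p ≠ c := by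
      rintro rfl
      exact hp (Or.inr rfl)
    rw [truncVec_of_lt hM hbp, if_neg hpc]
  · rw [projTwo_apply hab, truncVec_self hM hbc, truncVec_pred hM hab hbc, muVec]

lemma isMu_span (hM : IsUniUpper M) (hab : (a : ℕ) + 1 = b) (hbc : b < c)
    (h0 : M⁻¹ b c ≠ 0) :
    IsMu b (c + 1) M (Submodule.span E {muVec M a b c}) := by
  have hne : a ≠ b := by rintro rfl; omega
  refine ⟨s - (b + 1), ?_, finrank_span_singleton fun h => ?_⟩
  · rw [map_projTwo_muFiltration hab hbc]
    apply le_antisymm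
    · rw [Submodule.span_singleton_le_iff_mem]
      exact muVec_mem_map hM hab hbc (by omega)
    · rintro _ ⟨v, ⟨hv, hv'⟩, rfl⟩
      have hv := (mem_lastCols hM).1 hv
      have hbc' : (b : ℕ) < c := hbc
      exact projTwo_mem_span_muVec hM hab hbc hv' (hv a (by omega)) (hv b (by omega))
  · have := congrFun h b
    rw [muVec, pairVec_right hne] at this
    exact h0 (neg_eq_zero.1 this)

lemma IsMu.le_span (hM : IsUniUpper M) (hab : (a : ℕ) + 1 = b) (hbc : b < c)
    (h0 : M⁻¹ a c ≠ 0) {L : Submodule E (Fin s → E)} (hL : IsMu b (c + 1) M L) :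
    L ≤ Submodule.span E {muVec M a b c} := by
  have hne : a ≠ b := by rintro rfl; omega
  obtain ⟨i, hL, hrank⟩ := hL
  rw [map_projTwo_muFiltration hab hbc] at hL
  by_cases hi : (b : ℕ) + i < s
  · rw [hL]
    rintro _ ⟨v, ⟨hv, hv'⟩, rfl⟩
    have hv := (mem_lastCols hM).1 hv
    exact projTwo_mem_span_muVec hM hab hbc hv' (hv a (by omega)) (hv b hi)
  · have h1 : muVec M a b c ∈ L := hL ▸ muVec_mem_map hM hab hbc (by omega)
    have h2 : pairVec a b (-M⁻¹ a b) 1 ∈ L := by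
      rw [hL]
      refine ⟨fun k => M k b, ⟨Submodule.subset_span ⟨b, by omega, rfl⟩,
        col_mem_coordSpan hM le_rfl Set.subset_union_left⟩, ?_⟩
      rw [projTwo_apply hab, hM.2, hM.apply_succ hab]
    have h := mul_eq_mul_of_finrank_eq_one hne hrank h1 h2
    exact absurd (by linear_combination -h) h0

end InducedLines

section Torus

variable {s : ℕ}

lemma inv_mul_inv_eq {M M' : Matrix (Fin s) (Fin s) E} (hM : IsUniUpper M)
    (hM' : IsUniUpper M') {a b c : Fin s} (hab : (a : ℕ) + 1 = b) (hbc : b < c)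
    (hbc0 : M⁻¹ b c ≠ 0) (hac0 : M'⁻¹ a c ≠ 0) {α β : E} (hα : α ≠ 0) (hβ : β ≠ 0)
    (hlam : ∀ L : Submodule E (Fin s → E), IsLambda b M L →
      IsLambda b M' (Submodule.map (diagScale E s b α β) L))
    (hmu : ∀ L : Submodule E (Fin s → E), IsMu b (c + 1) M L →
      IsMu b (c + 1) M' (Submodule.map (diagScale E s b α β) L)) :
    M'⁻¹ a c * (M⁻¹ b c * M⁻¹ a b) = M'⁻¹ a b * M'⁻¹ b c * M⁻¹ a c := by
  have hne : a ≠ b := by rintro rfl; omega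
  have h1 := (hlam _ (isLambda_span hM hab)).le_span hM' hab
    (Submodule.mem_map_of_mem (Submodule.mem_span_singleton_self _))
  have h2 := (hmu _ (isMu_span hM hab hbc hbc0)).le_span hM' hab hbc hac0
    (Submodule.mem_map_of_mem (Submodule.mem_span_singleton_self _))
  rw [diagScale_pairVec hab, Submodule.mem_span_singleton] at h1
  rw [muVec, muVec, diagScale_pairVec hab, Submodule.mem_span_singleton] at h2
  obtain ⟨u, hu⟩ := h1
  obtain ⟨t, ht⟩ := h2
  rw [smul_pairVec] at hu ht
  obtain ⟨hu1, hu2⟩ := pairVec_ext hne hu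
  obtain ⟨ht1, ht2⟩ := pairVec_ext hne ht
  rw [mul_one, mul_one] at hu2
  subst hu2
  have ht0 : t ≠ 0 := by
    rintro rfl
    exact mul_ne_zero hβ hbc0 (by linear_combination ht2)
  have ebc : t * M'⁻¹ b c = u * M⁻¹ b c := by linear_combination -ht2
  have eab : u * M'⁻¹ a b = α * M⁻¹ a b := by linear_combination -hu1
  have eac : t * M'⁻¹ a c = α * M⁻¹ a c := by
    linear_combination -ht1 + M'⁻¹ a b * ebc + M⁻¹ b c * eab
  refine mul_left_cancel₀ (mul_ne_zero ht0 hα) ?_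
  linear_combination (α * M⁻¹ b c * M⁻¹ a b) * eac - (α * M⁻¹ a c * M'⁻¹ a b) * ebc
    - (α * M⁻¹ a c * M⁻¹ b c) * eab

lemma exists_diagonal_of_inv_relation {M M' : Matrix (Fin s) (Fin s) E} (hM : IsUniUpper M)
    (hM' : IsUniUpper M') (h0 : ∀ a c : Fin s, a < c → M⁻¹ a c ≠ 0)
    (h0' : ∀ a c : Fin s, a < c → M'⁻¹ a c ≠ 0)
    (h : ∀ a b c : Fin s, (a : ℕ) + 1 = b → b < c →
      M'⁻¹ a c * (M⁻¹ b c * M⁻¹ a b) = M'⁻¹ a b * M'⁻¹ b c * M⁻¹ a c) :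
    ∃ d : Fin s → E, (∀ p, d p ≠ 0) ∧ ∀ a c, M'⁻¹ a c * d c = d a * M⁻¹ a c := by
  let ρ : ℕ → E := fun j => if hj : j + 1 < s then
    M⁻¹ ⟨j, by omega⟩ ⟨j + 1, hj⟩ / M'⁻¹ ⟨j, by omega⟩ ⟨j + 1, hj⟩ else 1
  have hρ : ∀ j, ρ j ≠ 0 := fun j => by
    simp only [ρ]
    split_ifs with hj
    · exact div_ne_zero (h0 _ _ (Fin.lt_def.2 (Nat.lt_succ_self j)))
        (h0' _ _ (Fin.lt_def.2 (Nat.lt_succ_self j)))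
    · exact one_ne_zero
  let d : Fin s → E := fun p => ∏ j ∈ Finset.range p, ρ j
  have hsucc : ∀ a b : Fin s, (a : ℕ) + 1 = b → M'⁻¹ a b * d b = d a * M⁻¹ a b := by
    intro a b hab
    have hb : b = ⟨a + 1, by omega⟩ := Fin.ext hab.symm
    have hlt : a < b := Fin.lt_def.2 (by omega)
    have hρa : M'⁻¹ a b * ρ a = M⁻¹ a b := by
      have : ρ a = M⁻¹ a b / M'⁻¹ a b := by
        rw [hb]
        exact dif_pos (by omega)
      rw [this, mul_div_cancel₀ _ (h0' a b hlt)]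
    simp only [d, ← hab, Finset.prod_range_succ]
    linear_combination (∏ j ∈ Finset.range a, ρ j) * hρa
  refine ⟨d, fun p => Finset.prod_ne_zero_iff.2 fun j _ => hρ j, ?_⟩
  have hlt : ∀ n : ℕ, ∀ a c : Fin s, (a : ℕ) + n + 1 = c → M'⁻¹ a c * d c = d a * M⁻¹ a c := by
    intro n
    induction n with
    | zero => exact fun a c hac => hsucc a c hac
    | succ n ih =>
      intro a c hac
      obtain ⟨b, hb⟩ : ∃ b : Fin s, (a : ℕ) + 1 = b := ⟨⟨a + 1, by omega⟩, rfl⟩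
      have hbc : b < c := Fin.lt_def.2 (by omega)
      have hab : a < b := Fin.lt_def.2 (by omega)
      have e1 := ih b c (by omega)
      have e2 := hsucc a b hb
      refine mul_left_cancel₀ (mul_ne_zero (h0 b c hbc) (h0 a b hab)) ?_
      linear_combination d c * h a b c hb hbc + M'⁻¹ a b * M⁻¹ a c * e1
        + M⁻¹ b c * M⁻¹ a c * e2
  intro a c
  rcases lt_trichotomy a c with hac | rfl | hac
  · have : (a : ℕ) < c := hac
    exact hlt (c - a - 1) a c (by omega)
  · rw [hM.inv.2, hM'.inv.2, one_mul, mul_one]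
  · rw [hM.inv.1 a c hac, hM'.inv.1 a c hac, zero_mul, mul_zero]

lemma eq_conj_of_inv_relation {M M' : Matrix (Fin s) (Fin s) E} (hM : IsUniUpper M)
    (hM' : IsUniUpper M') {d : Fin s → E} (hd : ∀ p, d p ≠ 0)
    (h : ∀ a c, M'⁻¹ a c * d c = d a * M⁻¹ a c) :
    M' = Matrix.diagonal d * M * (Matrix.diagonal d)⁻¹ := by
  have hdet : IsUnit (Matrix.diagonal d).det := by
    rw [Matrix.det_diagonal, isUnit_iff_ne_zero]
    exact Finset.prod_ne_zero_iff.2 fun p _ => hd p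
  have hcomm : M'⁻¹ * Matrix.diagonal d = Matrix.diagonal d * M⁻¹ := by
    ext a c
    rw [Matrix.mul_diagonal, Matrix.diagonal_mul, h]
  have hDM : Matrix.diagonal d * M = M' * Matrix.diagonal d := by
    calc Matrix.diagonal d * M = M' * (M'⁻¹ * Matrix.diagonal d) * M := by
          rw [← Matrix.mul_assoc, Matrix.mul_nonsing_inv M' hM'.isUnit_det, Matrix.one_mul]
      _ = M' * Matrix.diagonal d := by
          rw [hcomm, Matrix.mul_assoc, Matrix.mul_assoc, Matrix.nonsing_inv_mul M hM.isUnit_det,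
            Matrix.mul_one]
  rw [hDM, Matrix.mul_assoc, Matrix.mul_nonsing_inv _ hdet, Matrix.mul_one]

end Torus

/-- Let `M, M' ∈ N_s` be non-critical.  If for every pair `(r,q)` with
`1 ≤ r` and `r+1 < q ≤ s` there is an invertible diagonal `2×2` matrix `d_{r,q}` acting on
`⟨e_r, e_{r+1}⟩` with `λ_r(M') = d_{r,q}·λ_r(M)` and `μ_{r,q}(M') = d_{r,q}·μ_{r,q}(M)`,
then there is an invertible diagonal `d ∈ GL_s(E)` with `M' = d M d⁻¹`. -/
theorem statement4
    {s : ℕ} (M M' : Matrix (Fin s) (Fin s) E)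
    (hM : IsUniUpper M) (hM' : IsUniUpper M')
    (hMnc : ∀ v : Equiv.Perm (Fin s), InBigCell (permMat E v * M * w0Mat E s))
    (hM'nc : ∀ v : Equiv.Perm (Fin s), InBigCell (permMat E v * M' * w0Mat E s))
    (h : ∀ r q : ℕ, 1 ≤ r → r + 1 < q → q ≤ s →
      ∃ α β : E, α ≠ 0 ∧ β ≠ 0 ∧
        (∀ L : Submodule E (Fin s → E), IsLambda r M L →
          IsLambda r M' (Submodule.map (diagScale E s r α β) L)) ∧
        (∀ L : Submodule E (Fin s → E), IsMu r q M L →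
          IsMu r q M' (Submodule.map (diagScale E s r α β) L))) :
    ∃ d : Fin s → E, (∀ p, d p ≠ 0) ∧
      M' = Matrix.diagonal d * M * (Matrix.diagonal d)⁻¹ := by
  obtain ⟨d, hd, hrel⟩ := exists_diagonal_of_inv_relation hM hM'
    (fun a c => inv_apply_ne_zero hM hMnc) (fun a c => inv_apply_ne_zero hM' hM'nc)
    (fun a b c hab hbc => by
      have hbc' : (b : ℕ) < c := hbc
      obtain ⟨α, β, hα, hβ, hlam, hmu⟩ := h b (c + 1) (by omega) (by omega) (by omega)
      have hlt : a < b := Fin.lt_def.2 (by omega)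
      exact inv_mul_inv_eq hM hM' hab hbc (inv_apply_ne_zero hM hMnc hbc)
        (inv_apply_ne_zero hM' hM'nc (hlt.trans hbc)) hα hβ hlam hmu)
  exact ⟨d, hd, eq_conj_of_inv_relation hM hM' hd hrel⟩

end Stmt4
end
end

section
/- Let φ₁,…,φ_n ∈ E^× be pairwise distinct, let φ ∈ End_E(E^n) be the diagonal operator with φ(e_i) = φ_i e_i, and let N ∈ End_E(E^n) be the nilpotent operator with N(e_{i+1}) = e_i for i ∈ S₀ and N(e_j) = 0 whenever j = 1 or j−1 ∉ S₀. Then the complete flags 0 = V₀ ⊊ V₁ ⊊ ⋯ ⊊ V_n = E^n satisfying φ(V_i) ⊆ V_i and N(V_i) ⊆ V_i for all i are exactly the flags V_j = span(e_{u⁻¹(1)},…,e_{u⁻¹(j)}) for u ∈ W_n^{S₀}; moreover distinct u ∈ W_n^{S₀} give distinct flags. (This is the paper's classification of all (φ,N)-stable complete flags in the Deligne–Fontaine module of a semistable (φ,Γ)-module with distinct Frobenius eigenvalues and monodromy type S₀.) -/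
/-!
Statement 12: classification of the `(φ,N)`-stable complete flags: for a diagonal `φ` with
pairwise distinct nonzero eigenvalues and the monodromy `N` of type `S₀`, the stable
complete flags are exactly the flags `V_j = ⟨e_{u⁻¹(1)},…,e_{u⁻¹(j)}⟩` for `u ∈ W_n^{S₀}`,
and distinct `u` give distinct flags.  All indexing is 0-based.
-/

open scoped Classical

noncomputable section

namespace Stmt12

/-- `u ∈ W_n^{S₀}` (0-based). -/
def WminRep {n : ℕ} (S0 : Set ℕ) (u : Equiv.Perm (Fin n)) : Prop :=
  ∀ i j : Fin n, (j : ℕ) = (i : ℕ) + 1 → (i : ℕ) ∈ S0 → u i < u j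

/-- The monodromy matrix `N` of type `S₀`: `N e_{i+1} = e_i` for `i ∈ S₀` and `N e_j = 0`
otherwise (0-based couplings). -/
def nilpMat (E : Type*) [Field E] {n : ℕ} (S0 : Set ℕ) : Matrix (Fin n) (Fin n) E :=
  Matrix.of fun i j => if (i : ℕ) + 1 = (j : ℕ) ∧ (i : ℕ) ∈ S0 then 1 else 0

/-- The `j`-th member `⟨e_{u⁻¹(1)},…,e_{u⁻¹(j)}⟩` of the flag attached to `u`. -/
def uFlag (E : Type*) [Field E] {n : ℕ} (u : Equiv.Perm (Fin n)) (j : ℕ) :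
    Submodule E (Fin n → E) :=
  Submodule.span E { v | ∃ k : Fin n, (k : ℕ) < j ∧ v = Pi.single (u.symm k) 1 }

theorem mem_uFlag {E : Type*} [Field E] {n : ℕ} (u : Equiv.Perm (Fin n)) (j : ℕ)
    (x : Fin n → E) : x ∈ uFlag E u j ↔ ∀ i, j ≤ (u i : ℕ) → x i = 0 := by
  constructor
  · intro hx
    induction hx using Submodule.span_induction with
    | mem v hv =>
      obtain ⟨k, hk, rfl⟩ := hv
      intro i hi
      refine Pi.single_eq_of_ne ?_ _
      rintro rfl
      rw [Equiv.apply_symm_apply] at hi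
      omega
    | zero => exact fun _ _ => rfl
    | add y z _ _ hy hz => exact fun i hi => by simp [hy i hi, hz i hi]
    | smul c y _ hy => exact fun i hi => by simp [hy i hi]
  · intro h
    rw [← Finset.univ_sum_single x]
    refine Submodule.sum_mem _ fun i _ => ?_
    by_cases hi : j ≤ (u i : ℕ)
    · simp [h i hi]
    · rw [← mul_one (x i), ← smul_eq_mul, Pi.single_smul]
      exact Submodule.smul_mem _ _ (Submodule.subset_span ⟨u i, not_le.mp hi, by simp⟩)

theorem single_mem_uFlag_iff {E : Type*} [Field E] {n : ℕ} (u : Equiv.Perm (Fin n)) (j : ℕ)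
    (i : Fin n) : (Pi.single i 1 : Fin n → E) ∈ uFlag E u j ↔ (u i : ℕ) < j := by
  rw [mem_uFlag]
  constructor
  · intro h
    by_contra hi
    simpa using h i (not_lt.mp hi)
  · intro h k hk
    refine Pi.single_eq_of_ne ?_ _
    rintro rfl
    omega

theorem nilpMat_mulVec_of_mem {E : Type*} [Field E] {n : ℕ} {S0 : Set ℕ} {i j : Fin n}
    (hij : (j : ℕ) = (i : ℕ) + 1) (hi : (i : ℕ) ∈ S0) (x : Fin n → E) :
    (nilpMat E S0).mulVec x i = x j := by
  have h (k : Fin n) : ((i : ℕ) + 1 = (k : ℕ) ∧ (i : ℕ) ∈ S0) ↔ j = k := by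
    rw [Fin.ext_iff, hij]
    tauto
  simp [Matrix.mulVec, dotProduct, nilpMat, h]

theorem nilpMat_mulVec_of_notMem {E : Type*} [Field E] {n : ℕ} {S0 : Set ℕ} {i : Fin n}
    (hi : (i : ℕ) ∉ S0) (x : Fin n → E) : (nilpMat E S0).mulVec x i = 0 := by
  simp [Matrix.mulVec, dotProduct, nilpMat, hi]

theorem nilpMat_mulVec_single {E : Type*} [Field E] {n : ℕ} {S0 : Set ℕ} {i j : Fin n}
    (hij : (j : ℕ) = (i : ℕ) + 1) (hi : (i : ℕ) ∈ S0) :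
    (nilpMat E S0).mulVec (Pi.single j 1) = Pi.single i 1 := by
  ext k
  have h : ((k : ℕ) + 1 = (j : ℕ) ∧ (k : ℕ) ∈ S0) ↔ k = i := by
    rw [Fin.ext_iff]
    constructor
    · omega
    · intro hk
      exact ⟨by omega, hk ▸ hi⟩
  simp [nilpMat, h, Pi.single_apply]

/-- A subspace stable under a diagonal operator with distinct eigenvalues is spanned by the
basis vectors it contains. -/
theorem single_mem_of_diagonal_stable {E : Type*} [Field E] {n : ℕ} {φv : Fin n → E}
    (hφ : Function.Injective φv) {W : Submodule E (Fin n → E)}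
    (hW : ∀ x ∈ W, (Matrix.diagonal φv).mulVec x ∈ W) {x : Fin n → E} (hx : x ∈ W)
    {i : Fin n} (hi : x i ≠ 0) : (Pi.single i 1 : Fin n → E) ∈ W := by
  have key (s : Finset (Fin n)) : (fun k => (∏ l ∈ s, (φv k - φv l)) * x k) ∈ W := by
    induction s using Finset.induction_on with
    | empty => simpa using hx
    | insert a s ha ih =>
      convert W.sub_mem (hW _ ih) (W.smul_mem (φv a) ih) using 1
      ext k
      simp only [Finset.prod_insert ha, Pi.sub_apply, Matrix.mulVec_diagonal, Pi.smul_apply,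
        smul_eq_mul]
      ring
  have hc : (∏ l ∈ Finset.univ.erase i, (φv i - φv l)) * x i ≠ 0 := by
    refine mul_ne_zero (Finset.prod_ne_zero_iff.mpr fun l hl => ?_) hi
    exact sub_ne_zero.mpr fun h => Finset.ne_of_mem_erase hl (hφ h).symm
  rw [← W.smul_mem_iff hc]
  convert key (Finset.univ.erase i) using 1
  ext k
  by_cases hk : k = i
  · subst hk
    simp
  · have : ∏ l ∈ Finset.univ.erase i, (φv k - φv l) = 0 :=
      Finset.prod_eq_zero (Finset.mem_erase.mpr ⟨hk, Finset.mem_univ k⟩) (sub_self _)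
    simp [hk, this]

/-- Subspaces stable under a diagonal operator with distinct eigenvalues are compared through
the basis vectors they contain. -/
theorem le_of_single_mem {E : Type*} [Field E] {n : ℕ} {φv : Fin n → E}
    (hφ : Function.Injective φv) {W W' : Submodule E (Fin n → E)}
    (hW : ∀ x ∈ W, (Matrix.diagonal φv).mulVec x ∈ W)
    (h : ∀ i, (Pi.single i 1 : Fin n → E) ∈ W → (Pi.single i 1 : Fin n → E) ∈ W') :
    W ≤ W' := by
  intro x hx
  rw [← Finset.univ_sum_single x]
  refine Submodule.sum_mem _ fun i _ => ?_
  by_cases hi : x i = 0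
  · simp [hi]
  · rw [← mul_one (x i), ← smul_eq_mul, Pi.single_smul]
    exact W'.smul_mem _ (h i (single_mem_of_diagonal_stable hφ hW hx hi))

theorem diagonal_mulVec_mem_uFlag {E : Type*} [Field E] {n : ℕ} (φv : Fin n → E)
    (u : Equiv.Perm (Fin n)) (j : ℕ) {x : Fin n → E} (hx : x ∈ uFlag E u j) :
    (Matrix.diagonal φv).mulVec x ∈ uFlag E u j := by
  rw [mem_uFlag] at hx ⊢
  intro i hi
  rw [Matrix.mulVec_diagonal, hx i hi, mul_zero]

theorem nilpMat_mulVec_mem_uFlag {E : Type*} [Field E] {n : ℕ} {S0 : Set ℕ}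
    (hS0 : ∀ i ∈ S0, i + 1 < n) {u : Equiv.Perm (Fin n)} (hu : WminRep S0 u) (j : ℕ)
    {x : Fin n → E} (hx : x ∈ uFlag E u j) : (nilpMat E S0).mulVec x ∈ uFlag E u j := by
  rw [mem_uFlag] at hx ⊢
  intro i hi
  by_cases hiS : (i : ℕ) ∈ S0
  · rw [nilpMat_mulVec_of_mem (j := ⟨i + 1, hS0 i hiS⟩) rfl hiS]
    exact hx _ (hi.trans (hu i _ rfl hiS).le)
  · exact nilpMat_mulVec_of_notMem hiS x

theorem strictMono_uFlag {E : Type*} [Field E] {n : ℕ} (u : Equiv.Perm (Fin n)) :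
    StrictMono fun j : Fin (n + 1) => uFlag E u (j : ℕ) := by
  refine Fin.strictMono_iff_lt_succ.mpr fun k => lt_of_le_of_ne ?_ fun h => ?_
  · intro x hx
    rw [mem_uFlag] at hx ⊢
    exact fun i hi => hx i (le_trans (by simp) hi)
  · have h' := single_mem_uFlag_iff (E := E) u (k.castSucc : Fin (n + 1)) (u.symm k)
    rw [h, single_mem_uFlag_iff] at h'
    simp at h'

/-- A complete flag stable under a diagonal operator with distinct eigenvalues is a coordinate
flag. -/
theorem exists_eq_uFlag {E : Type*} [Field E] {n : ℕ} {φv : Fin n → E}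
    (hφ : Function.Injective φv) {V : Fin (n + 1) → Submodule E (Fin n → E)}
    (hV : StrictMono V) (hst : ∀ j, ∀ x ∈ V j, (Matrix.diagonal φv).mulVec x ∈ V j) :
    ∃ u : Equiv.Perm (Fin n), ∀ j : Fin (n + 1), V j = uFlag E u (j : ℕ) := by
  have hex (k : Fin n) : ∃ i, (Pi.single i 1 : Fin n → E) ∈ V k.succ ∧
      (Pi.single i 1 : Fin n → E) ∉ V k.castSucc := by
    by_contra! h
    exact (hV k.castSucc_lt_succ).not_ge (le_of_single_mem hφ (hst _) h)
  choose w hw hw' using hex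
  have hlt {k l : Fin n} (hkl : k < l) : w k ≠ w l := fun h =>
    hw' l (h ▸ hV.monotone (Fin.succ_le_castSucc_iff.mpr hkl) (hw k))
  have hinj : Function.Injective w := fun k l h => by
    by_contra hne
    rcases lt_or_gt_of_ne hne with hkl | hkl
    · exact hlt hkl h
    · exact hlt hkl h.symm
  let e : Equiv.Perm (Fin n) := Equiv.ofBijective w (Finite.injective_iff_bijective.mp hinj)
  have hmem (j : Fin (n + 1)) (i : Fin n) :
      (Pi.single i 1 : Fin n → E) ∈ V j ↔ (Pi.single i 1 : Fin n → E) ∈ uFlag E e.symm j := by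
    obtain ⟨k, rfl⟩ := e.surjective i
    rw [single_mem_uFlag_iff, Equiv.symm_apply_apply]
    constructor
    · intro h
      by_contra hk
      exact hw' k (hV.monotone (Fin.le_def.mpr (not_lt.mp hk)) h)
    · intro hk
      exact hV.monotone (Fin.le_def.mpr (by simpa using hk)) (hw k)
  exact ⟨e.symm, fun j => le_antisymm
    (le_of_single_mem hφ (hst j) fun i => (hmem j i).mp)
    (le_of_single_mem hφ (fun _ => diagonal_mulVec_mem_uFlag φv _ _) fun i => (hmem j i).mpr)⟩

/-- Let `φ₁,…,φ_n ∈ E^×` be pairwise distinct, `φ` the diagonal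
operator `φ(eᵢ) = φᵢ eᵢ`, and `N` the monodromy of type `S₀`.  Then the complete flags
`0 = V₀ ⊊ ⋯ ⊊ V_n = Eⁿ` stable under `φ` and `N` are exactly the flags
`V_j = ⟨e_{u⁻¹(1)},…,e_{u⁻¹(j)}⟩` for `u ∈ W_n^{S₀}`, and distinct `u ∈ W_n^{S₀}` give
distinct flags. -/
theorem statement12
    {E : Type*} [Field E] {n : ℕ} (S0 : Set ℕ) (hS0 : ∀ i ∈ S0, i + 1 < n)
    (φv : Fin n → E) (hφ0 : ∀ i, φv i ≠ 0) (hφ : Function.Injective φv) :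
    (∀ V : Fin (n + 1) → Submodule E (Fin n → E),
      (V 0 = ⊥ ∧ V (Fin.last n) = ⊤ ∧ StrictMono V ∧
        ∀ (i : Fin (n + 1)) (x : Fin n → E), x ∈ V i →
          (Matrix.diagonal φv).mulVec x ∈ V i ∧ (nilpMat E S0).mulVec x ∈ V i)
      ↔ ∃ u : Equiv.Perm (Fin n), WminRep S0 u ∧
          ∀ j : Fin (n + 1), V j = uFlag E u (j : ℕ)) ∧
    (∀ u u' : Equiv.Perm (Fin n), WminRep S0 u → WminRep S0 u' →
      (∀ j : Fin (n + 1), uFlag E u (j : ℕ) = uFlag E u' (j : ℕ)) → u = u') := by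
  refine ⟨fun V => ⟨?_, ?_⟩, fun u u' _ _ h => ?_⟩
  · rintro ⟨-, -, hmono, hst⟩
    obtain ⟨u, hu⟩ := exists_eq_uFlag hφ hmono fun j x hx => (hst j x hx).1
    refine ⟨u, fun i j hij hi => ?_, hu⟩
    have hj : (Pi.single j 1 : Fin n → E) ∈ V (u j).succ := by
      rw [hu, single_mem_uFlag_iff]
      simp
    have hi' := (hst _ _ hj).2
    rw [nilpMat_mulVec_single hij hi, hu, single_mem_uFlag_iff, Fin.val_succ] at hi'
    refine lt_of_le_of_ne (Fin.le_def.mpr (Nat.lt_succ_iff.mp hi')) fun h => ?_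
    have := congrArg Fin.val (u.injective h)
    omega
  · rintro ⟨u, hu, hV⟩
    obtain rfl : V = fun j : Fin (n + 1) => uFlag E u (j : ℕ) := funext hV
    refine ⟨?_, ?_, strictMono_uFlag u, fun j x hx =>
      ⟨diagonal_mulVec_mem_uFlag φv u _ hx, nilpMat_mulVec_mem_uFlag hS0 hu _ hx⟩⟩
    · refine (Submodule.eq_bot_iff _).mpr fun x hx => ?_
      rw [mem_uFlag] at hx
      exact funext fun i => hx i (Nat.zero_le _)
    · refine Submodule.eq_top_iff'.mpr fun x => ?_
      rw [mem_uFlag]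
      exact fun i hi => absurd (u i).isLt (not_lt.mpr hi)
  · have hlt (i : Fin n) (j : Fin (n + 1)) : (u i : ℕ) < j ↔ (u' i : ℕ) < j := by
      rw [← single_mem_uFlag_iff (E := E), h, single_mem_uFlag_iff]
    ext i
    have h₁ := hlt i (u i).succ
    have h₂ := hlt i (u' i).succ
    simp only [Fin.val_succ] at h₁ h₂
    omega

end Stmt12
end
end
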